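/- arXiv:1309.5847 — 2 statements merged into one kernel-verified Lean document; each statement's English description precedes it below -/
import Mathlib

section
/- Let k ≥ 1 and j be integers with 2j−2 ≥ k. Identify a Laurent polynomial p̄ supported in degrees k−j+1 ≤ l ≤ j−1 with its coefficient vector in ℂ^{2j−k−1}. Then the map sending a nonzero such p̄ to the isomorphism class of T_{p̄} = [[z^j, u·p̄],[0, z^{−j}]] descends to a well-defined bijection from the complex projective space ℙ^{2j−k−2} = ℙ(ℂ^{2j−k−1}) onto the set of isomorphism classes of matrices T_{p̄} with p̄ ≠ 0 supported in [k−j+1, j−1]. (This identifies the moduli space 𝔐¹_j(Z_k, 0) of nontrivial first-order deformations of O(j) ⊕ O(−j) on Z_k with ℙ^{2j−k−2}.) -/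
open LaurentPolynomial

noncomputable section

/-- The ring `R = ℂ[z,z⁻¹][u]/(u²)`, with `u = inr 1`. -/
abbrev RZ : Type := TrivSqZeroExt (LaurentPolynomial ℂ) (LaurentPolynomial ℂ)

/-- `p` is a Laurent polynomial supported in degrees `l` with `a ≤ l ≤ b`. -/
def SuppIcc (a b : ℤ) (p : LaurentPolynomial ℂ) : Prop :=
  ∃ c : ℤ → ℂ, p = ∑ l ∈ Finset.Icc a b, c l • T l

/-- `p` lies in `ℂ[z] ⊆ ℂ[z,z⁻¹]`. -/
def InPolyZ (p : LaurentPolynomial ℂ) : Prop := ∃ N : ℤ, SuppIcc 0 N p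

/-- `p` lies in `z^m·ℂ[z⁻¹]`, i.e. is supported in degrees `≤ m`. -/
def SuppLe (m : ℤ) (p : LaurentPolynomial ℂ) : Prop := ∃ N : ℤ, SuppIcc N m p

/-- The subring `O_U = { f(z) + g(z)·u }` of `R`. -/
def OU : Set RZ := { x | InPolyZ x.fst ∧ InPolyZ x.snd }

/-- The subring `O_V = { f(z⁻¹) + g(z⁻¹)·zᵏ·u }` of `R`. -/
def OV (k : ℤ) : Set RZ := { x | SuppLe 0 x.fst ∧ SuppLe k x.snd }

/-- Two 2×2 matrices `T`, `T'` over a ring `A` are isomorphic with respect to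
subrings (given as subsets) `SU`, `SV` if `T'·M = N·T` for some matrices `M` (entries
in `SU`) and `N` (entries in `SV`), each invertible with inverse entries in the
same subring. -/
def MatIso {A : Type*} [Ring A] (SU SV : Set A)
    (T T' : Matrix (Fin 2) (Fin 2) A) : Prop :=
  ∃ M M' N N' : Matrix (Fin 2) (Fin 2) A,
    (∀ a b, M a b ∈ SU) ∧ (∀ a b, M' a b ∈ SU) ∧
    (∀ a b, N a b ∈ SV) ∧ (∀ a b, N' a b ∈ SV) ∧
    M * M' = 1 ∧ M' * M = 1 ∧ N * N' = 1 ∧ N' * N = 1 ∧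
    T' * M = N * T

/-- The transition matrix `[[z^{d₁}, u·p],[0, z^{d₂}]]` over `R`. -/
def Tmat (d₁ d₂ : ℤ) (p : LaurentPolynomial ℂ) : Matrix (Fin 2) (Fin 2) RZ :=
  !![TrivSqZeroExt.inl (T d₁), TrivSqZeroExt.inr p;
     0, TrivSqZeroExt.inl (T d₂)]

/-- The Laurent polynomial supported in degrees `[k-j+1, j-1]` with coefficient
vector `v ∈ ℂ^{2j-k-1}` (coefficient `v t` in degree `k-j+1+t`). -/
def polyOfZ (k j : ℤ) (v : Fin (2 * j - k - 1).toNat → ℂ) : LaurentPolynomial ℂ :=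
  ∑ t : Fin (2 * j - k - 1).toNat, v t • T (k - j + 1 + (t : ℤ))

/-- Isomorphism of the transition matrices `T_{p̄} = [[z^j, u·p̄],[0, z^{-j}]]`, as a
relation on nonzero coefficient vectors. -/
def relZ0 (k j : ℤ) (v w : {v : Fin (2 * j - k - 1).toNat → ℂ // v ≠ 0}) : Prop :=
  MatIso OU (OV k) (Tmat j (-j) (polyOfZ k j v)) (Tmat j (-j) (polyOfZ k j w))

theorem coeff_T_mul (m n : ℤ) (p : LaurentPolynomial ℂ) :
    (T m * p).coeff n = p.coeff (n - m) := by
  rw [T, AddMonoidAlgebra.coeff_single_mul_apply, one_mul, neg_add_eq_sub]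

theorem SuppIcc.coeff_eq_zero {a b n : ℤ} {p : LaurentPolynomial ℂ} (h : SuppIcc a b p)
    (hn : n < a ∨ b < n) : p.coeff n = 0 := by
  obtain ⟨c, rfl⟩ := h
  rw [AddMonoidAlgebra.coeff_sum, Finsupp.finsetSum_apply]
  refine Finset.sum_eq_zero fun l hl => ?_
  rw [Finset.mem_Icc] at hl
  have hne : l ≠ n := by lia
  simp [hne]

theorem InPolyZ.coeff_eq_zero {n : ℤ} {p : LaurentPolynomial ℂ} (h : InPolyZ p) (hn : n < 0) :
    p.coeff n = 0 :=
  h.elim fun _ h => h.coeff_eq_zero (.inl hn)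

theorem SuppLe.coeff_eq_zero {m n : ℤ} {p : LaurentPolynomial ℂ} (h : SuppLe m p) (hn : m < n) :
    p.coeff n = 0 :=
  h.elim fun _ h => h.coeff_eq_zero (.inr hn)

theorem inPolyZ_C (a : ℂ) : InPolyZ (C a) :=
  ⟨0, fun _ => a, by simp [smul_eq_C_mul]⟩

theorem suppLe_C {m : ℤ} (hm : 0 ≤ m) (a : ℂ) : SuppLe m (C a) := by
  refine ⟨0, fun l => if l = 0 then a else 0, ?_⟩
  rw [Finset.sum_eq_single_of_mem 0 (by simpa using hm) fun l _ hl => by simp [hl]]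
  simp [smul_eq_C_mul]

/-- Constants, embedded in `R`, lie in `O_U`. -/
theorem inl_C_mem_OU (a : ℂ) : (TrivSqZeroExt.inl (C a) : RZ) ∈ OU :=
  ⟨inPolyZ_C a, by simpa using inPolyZ_C 0⟩

/-- Constants, embedded in `R`, lie in `O_V`. -/
theorem inl_C_mem_OV {k : ℤ} (hk : 0 ≤ k) (a : ℂ) : (TrivSqZeroExt.inl (C a) : RZ) ∈ OV k :=
  ⟨suppLe_C le_rfl a, by simpa using suppLe_C hk 0⟩

theorem coeff_polyOfZ (k j : ℤ) (v : Fin (2 * j - k - 1).toNat → ℂ)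
    (t : Fin (2 * j - k - 1).toNat) : (polyOfZ k j v).coeff (k - j + 1 + t) = v t := by
  rw [polyOfZ, AddMonoidAlgebra.coeff_sum, Finsupp.finsetSum_apply,
    Finset.sum_eq_single_of_mem t (Finset.mem_univ t) fun s _ hs => ?_]
  · simp
  · have hne : (s : ℤ) ≠ t := by simpa [Fin.ext_iff] using hs
    simp [hne]

theorem polyOfZ_smul (k j : ℤ) (c : ℂ) (v : Fin (2 * j - k - 1).toNat → ℂ) :
    polyOfZ k j (c • v) = C c * polyOfZ k j v := by
  simp only [polyOfZ, ← smul_eq_C_mul, Finset.smul_sum, Pi.smul_apply, smul_eq_mul, mul_smul]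

/-- A polynomial in `z` that is also a polynomial in `z⁻¹` is constant. -/
theorem eq_C_of_inPolyZ_of_suppLe {p : LaurentPolynomial ℂ} (h : InPolyZ p) (h' : SuppLe 0 p) :
    p = C (p.coeff 0) := by
  ext n
  rw [C_apply]
  split_ifs with hn
  · rw [hn]
  · rcases lt_or_gt_of_ne hn with hn | hn
    · exact h.coeff_eq_zero hn
    · exact h'.coeff_eq_zero hn

/-- Rescaling the extension class by a nonzero constant does not change the bundle. -/
theorem matIso_Tmat_C_mul {k : ℤ} (hk : 0 ≤ k) (d₁ d₂ : ℤ) (p : LaurentPolynomial ℂ) {c : ℂ}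
    (hc : c ≠ 0) : MatIso OU (OV k) (Tmat d₁ d₂ (C c * p)) (Tmat d₁ d₂ p) := by
  let D (a : ℂ) : Matrix (Fin 2) (Fin 2) RZ :=
    !![TrivSqZeroExt.inl (C 1), TrivSqZeroExt.inl (C 0);
      TrivSqZeroExt.inl (C 0), TrivSqZeroExt.inl (C a)]
  have hU (a : ℂ) (r s : Fin 2) : D a r s ∈ OU := by
    fin_cases r <;> fin_cases s <;> exact inl_C_mem_OU _
  have hV (a : ℂ) (r s : Fin 2) : D a r s ∈ OV k := by
    fin_cases r <;> fin_cases s <;> exact inl_C_mem_OV hk _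
  have hD (a b : ℂ) (hab : a * b = 1) : D a * D b = 1 := by
    simp [D, Matrix.one_fin_two, ← TrivSqZeroExt.inl_mul, ← map_mul, hab]
  refine ⟨D c, D c⁻¹, D c, D c⁻¹, hU _, hU _, hV _, hV _, hD _ _ (mul_inv_cancel₀ hc),
    hD _ _ (inv_mul_cancel₀ hc), hD _ _ (mul_inv_cancel₀ hc), hD _ _ (inv_mul_cancel₀ hc), ?_⟩
  simp [D, Tmat, ← TrivSqZeroExt.inl_mul]
  ext <;> simp [mul_comm]

/-- Isomorphic extensions of `O(-j)` by `O(j)` have extension classes that are proportional in the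
degrees strictly between `k - j` and `j`. -/
theorem MatIso.exists_coeff_eq {k j : ℤ} (hj : 0 < j) {p q : LaurentPolynomial ℂ}
    (h : MatIso OU (OV k) (Tmat j (-j) p) (Tmat j (-j) q)) :
    ∃ c : ℂ, c ≠ 0 ∧ ∀ l, k - j < l → l < j → p.coeff l = c * q.coeff l := by
  obtain ⟨M, M', N, N', hM, hM', hN, hN', hMM', hM'M, -, -, hT⟩ := h
  have h00 := congrArg TrivSqZeroExt.fst (congrFun₂ hT 0 0)
  have h01 := congrArg TrivSqZeroExt.fst (congrFun₂ hT 0 1)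
  have h11 := congrArg TrivSqZeroExt.fst (congrFun₂ hT 1 1)
  have h01' := congrArg TrivSqZeroExt.snd (congrFun₂ hT 0 1)
  have e00 := congrArg TrivSqZeroExt.fst (congrFun₂ hMM' 0 0)
  have e11 := congrArg TrivSqZeroExt.fst (congrFun₂ hM'M 1 1)
  simp only [Tmat, Matrix.mul_apply, Fin.sum_univ_two, Matrix.of_apply, Matrix.cons_val_zero,
    Matrix.cons_val_one, Matrix.cons_val', Matrix.cons_val_fin_one, Matrix.one_apply_eq,
    TrivSqZeroExt.fst_add, TrivSqZeroExt.snd_add, TrivSqZeroExt.fst_mul, TrivSqZeroExt.snd_mul,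
    TrivSqZeroExt.fst_inl, TrivSqZeroExt.snd_inl, TrivSqZeroExt.fst_inr, TrivSqZeroExt.snd_inr,
    TrivSqZeroExt.fst_one, smul_eq_mul,
    MulOpposite.smul_eq_mul_unop, MulOpposite.unop_op, zero_mul, mul_zero, add_zero,
    zero_add] at h00 h01 h11 h01' e00 e11
  set a := (M 0 0).fst with ha
  set b := (M 0 1).fst with hb
  set d := (M 1 1).fst with hd
  have haN : a = (N 0 0).fst := (isUnit_T j).mul_left_cancel (h00.trans (mul_comm _ _))
  have hdN : d = (N 1 1).fst := (isUnit_T (-j)).mul_left_cancel (h11.trans (mul_comm _ _))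
  have hb0 : b = 0 := by
    ext n
    rcases lt_or_ge n 0 with hn | hn
    · exact (hM 0 1).1.coeff_eq_zero hn
    · have hc := congrArg (fun f => f.coeff (n + j)) h01
      simp only [mul_comm _ (T (-j)), coeff_T_mul] at hc
      rw [(hN 0 1).1.coeff_eq_zero (by lia)] at hc
      simpa using hc
  have haC := eq_C_of_inPolyZ_of_suppLe (hM 0 0).1 (ha ▸ haN ▸ (hN 0 0).1)
  have hdC := eq_C_of_inPolyZ_of_suppLe (hM 1 1).1 (hd ▸ hdN ▸ (hN 1 1).1)
  rw [← ha] at haC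
  rw [← hd] at hdC
  have ha0 : a.coeff 0 ≠ 0 := fun h0 => by
    rw [hb0, haC, h0] at e00
    simp at e00
  have hd0 : d.coeff 0 ≠ 0 := fun h0 => by
    rw [hb0, hdC, h0] at e11
    simp at e11
  refine ⟨d.coeff 0 / a.coeff 0, div_ne_zero hd0 ha0, fun l hkl hlj => ?_⟩
  have hl := congrArg (fun f => f.coeff l) h01'
  rw [← haN, haC, hdC] at hl
  simp only [mul_comm _ (T (-j)), mul_comm _ (C _), ← smul_eq_C_mul, AddMonoidAlgebra.coeff_add,
    AddMonoidAlgebra.coeff_smul, Finsupp.add_apply, Finsupp.smul_apply, smul_eq_mul,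
    coeff_T_mul] at hl
  rw [(hM 0 1).2.coeff_eq_zero (by lia), (hN 0 1).2.coeff_eq_zero (by lia)] at hl
  field_simp
  linear_combination -hl

theorem relZ0_iff {k j : ℤ} (hk : 0 ≤ k) (hj : 0 < j)
    (v w : {v : Fin (2 * j - k - 1).toNat → ℂ // v ≠ 0}) :
    relZ0 k j v w ↔ (projectivizationSetoid ℂ (Fin (2 * j - k - 1).toNat → ℂ)) v w := by
  refine ⟨fun h => ?_, ?_⟩
  · obtain ⟨c, hc, h⟩ := h.exists_coeff_eq hj
    refine ⟨Units.mk0 c hc, funext fun t => ?_⟩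
    have htlt := t.isLt
    have ht := h (k - j + 1 + t) (by omega) (by omega)
    rw [coeff_polyOfZ, coeff_polyOfZ] at ht
    exact ht.symm
  · rintro ⟨c, hc⟩
    have hv : (v : Fin (2 * j - k - 1).toNat → ℂ) = (c : ℂ) • w := hc.symm
    rw [relZ0, hv, polyOfZ_smul]
    exact matIso_Tmat_C_mul hk _ _ _ c.ne_zero

theorem stmt2 (k j : ℤ) (hk : 1 ≤ k) (hj : k ≤ 2 * j - 2) :
    ∃ e : Projectivization ℂ (Fin (2 * j - k - 1).toNat → ℂ) ≃ Quot (relZ0 k j),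
      ∀ (v : Fin (2 * j - k - 1).toNat → ℂ) (hv : v ≠ 0),
        e (Projectivization.mk ℂ v hv) = Quot.mk (relZ0 k j) ⟨v, hv⟩ := by
  exact ⟨Quot.congrRight fun v w => (relZ0_iff (by lia) (by lia) v w).symm, fun _ _ => rfl⟩
end
end

section
/- Let k ≥ 1 and j ≥ 0 be integers. Then for every Laurent polynomial p̄ ∈ ℂ[z,z⁻¹] there exists a Laurent polynomial p̄′ supported in degrees l with k−j+1 ≤ l ≤ j−1 such that the matrices T_{p̄} = [[z^j, u·p̄],[0, z^{−j}]] and T_{p̄′} = [[z^j, u·p̄′],[0, z^{−j}]] are isomorphic. (Canonical form for first-order extension classes on Z_k.) -/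
open LaurentPolynomial

noncomputable section

lemma SuppIcc.mono {a b a' b' : ℤ} {p : LaurentPolynomial ℂ} (h : SuppIcc a b p)
    (ha : a' ≤ a) (hb : b ≤ b') : SuppIcc a' b' p := by
  classical
  obtain ⟨c, rfl⟩ := h
  refine ⟨fun l => if l ∈ Finset.Icc a b then c l else 0, ?_⟩
  rw [← Finset.sum_subset (Finset.Icc_subset_Icc ha hb)]
  · exact Finset.sum_congr rfl fun l hl => by simp only [if_pos hl]
  · intro l _ hl
    simp only [if_neg hl, zero_smul]

lemma SuppIcc.add {a b : ℤ} {p q : LaurentPolynomial ℂ} (hp : SuppIcc a b p)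
    (hq : SuppIcc a b q) : SuppIcc a b (p + q) := by
  obtain ⟨c, rfl⟩ := hp
  obtain ⟨d, rfl⟩ := hq
  exact ⟨c + d, by simp only [Pi.add_apply, add_smul, Finset.sum_add_distrib]⟩

lemma SuppIcc.neg {a b : ℤ} {p : LaurentPolynomial ℂ} (hp : SuppIcc a b p) :
    SuppIcc a b (-p) := by
  obtain ⟨c, rfl⟩ := hp
  exact ⟨-c, by simp only [Pi.neg_apply, neg_smul, Finset.sum_neg_distrib]⟩

lemma suppIcc_zero (a b : ℤ) : SuppIcc a b 0 := ⟨0, by simp⟩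

lemma suppIcc_smul_T (x : ℂ) (n : ℤ) : SuppIcc n n (x • T n) := ⟨fun _ => x, by simp⟩

lemma InPolyZ.add {p q : LaurentPolynomial ℂ} (hp : InPolyZ p) (hq : InPolyZ q) :
    InPolyZ (p + q) := by
  obtain ⟨N, hp⟩ := hp
  obtain ⟨N', hq⟩ := hq
  exact ⟨max N N', (hp.mono le_rfl (le_max_left _ _)).add (hq.mono le_rfl (le_max_right _ _))⟩

lemma SuppLe.add {m : ℤ} {p q : LaurentPolynomial ℂ} (hp : SuppLe m p) (hq : SuppLe m q) :
    SuppLe m (p + q) := by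
  obtain ⟨N, hp⟩ := hp
  obtain ⟨N', hq⟩ := hq
  exact ⟨min N N', (hp.mono (min_le_left _ _) le_rfl).add (hq.mono (min_le_right _ _) le_rfl)⟩

lemma InPolyZ.neg {p : LaurentPolynomial ℂ} (hp : InPolyZ p) : InPolyZ (-p) :=
  hp.imp fun _ h => h.neg

lemma SuppLe.neg {m : ℤ} {p : LaurentPolynomial ℂ} (hp : SuppLe m p) : SuppLe m (-p) :=
  hp.imp fun _ h => h.neg

lemma inPolyZ_zero : InPolyZ 0 := ⟨0, suppIcc_zero _ _⟩

lemma inPolyZ_one : InPolyZ 1 := ⟨0, by simpa using suppIcc_smul_T 1 0⟩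

lemma suppLe_zero (m : ℤ) : SuppLe m 0 := ⟨0, suppIcc_zero _ _⟩

lemma suppLe_zero_one : SuppLe 0 1 := ⟨0, by simpa using suppIcc_smul_T 1 0⟩

/-- Every Laurent polynomial splits into a part of degrees `≥ j`, a part of degrees `≤ k - j`,
and a remainder supported strictly in between. -/
lemma exists_suppIcc_decomposition (k j : ℤ) (p : LaurentPolynomial ℂ) :
    ∃ f g q : LaurentPolynomial ℂ, InPolyZ f ∧ SuppLe k g ∧ SuppIcc (k - j + 1) (j - 1) q ∧
      p = T j * f + g * T (-j) + q := by
  induction p using LaurentPolynomial.induction_on' with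
  | add p p' hp hp' =>
    obtain ⟨f, g, q, hf, hg, hq, rfl⟩ := hp
    obtain ⟨f', g', q', hf', hg', hq', rfl⟩ := hp'
    exact ⟨f + f', g + g', q + q', hf.add hf', hg.add hg', hq.add hq', by ring⟩
  | C_mul_T n x =>
    rw [← LaurentPolynomial.smul_eq_C_mul]
    by_cases h₁ : j ≤ n
    · refine ⟨x • T (n - j), 0, 0, ⟨n - j, (suppIcc_smul_T x _).mono (by lia) le_rfl⟩,
        suppLe_zero k, suppIcc_zero _ _, ?_⟩
      rw [mul_smul_comm, ← T_add]
      simp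
    · by_cases h₂ : n ≤ k - j
      · refine ⟨0, x • T (n + j), 0, inPolyZ_zero,
          ⟨n + j, (suppIcc_smul_T x _).mono le_rfl (by lia)⟩, suppIcc_zero _ _, ?_⟩
        rw [smul_mul_assoc, ← T_add]
        simp
      · exact ⟨0, 0, x • T n, inPolyZ_zero, suppLe_zero k,
          (suppIcc_smul_T x n).mono (by lia) (by lia), by simp⟩

/-- The unipotent matrix `[[1, u·f],[0, 1]]` over `R`. -/
def unipotent (f : LaurentPolynomial ℂ) : Matrix (Fin 2) (Fin 2) RZ :=
  !![1, TrivSqZeroExt.inr f; 0, 1]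

lemma unipotent_mul (f g : LaurentPolynomial ℂ) :
    unipotent f * unipotent g = unipotent (f + g) := by
  simp [unipotent, add_comm, -DualNumber.inr_eq_smul_eps]

lemma unipotent_zero : unipotent 0 = 1 := by
  simp [unipotent, Matrix.one_fin_two]

lemma unipotent_mem_OU {f : LaurentPolynomial ℂ} (hf : InPolyZ f) (a b : Fin 2) :
    unipotent f a b ∈ OU := by
  fin_cases a <;> fin_cases b <;> simp [unipotent, OU, inPolyZ_zero, inPolyZ_one, hf]

lemma unipotent_mem_OV {k : ℤ} {g : LaurentPolynomial ℂ} (hg : SuppLe k g) (a b : Fin 2) :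
    unipotent g a b ∈ OV k := by
  fin_cases a <;> fin_cases b <;> simp [unipotent, OV, suppLe_zero, suppLe_zero_one, hg]

lemma Tmat_mul_unipotent (d₁ d₂ : ℤ) (p f : LaurentPolynomial ℂ) :
    Tmat d₁ d₂ p * unipotent f = Tmat d₁ d₂ (T d₁ * f + p) := by
  simp [Tmat, unipotent, TrivSqZeroExt.inl_mul_inr, -DualNumber.inr_eq_smul_eps]

lemma unipotent_mul_Tmat (d₁ d₂ : ℤ) (p g : LaurentPolynomial ℂ) :
    unipotent g * Tmat d₁ d₂ p = Tmat d₁ d₂ (p + g * T d₂) := by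
  simp [Tmat, unipotent, TrivSqZeroExt.inr_mul_inl, -DualNumber.inr_eq_smul_eps]

theorem stmt5 (k j : ℤ) (hk : 1 ≤ k) (hj : 0 ≤ j) (p : LaurentPolynomial ℂ) :
    ∃ p' : LaurentPolynomial ℂ, SuppIcc (k - j + 1) (j - 1) p' ∧
      MatIso OU (OV k) (Tmat j (-j) p) (Tmat j (-j) p') := by
  obtain ⟨f, g, q, hf, hg, hq, rfl⟩ := exists_suppIcc_decomposition k j p
  refine ⟨q, hq, unipotent f, unipotent (-f), unipotent (-g), unipotent g,
    unipotent_mem_OU hf, unipotent_mem_OU hf.neg, unipotent_mem_OV hg.neg, unipotent_mem_OV hg,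
    ?_, ?_, ?_, ?_, ?_⟩
  · rw [unipotent_mul, add_neg_cancel, unipotent_zero]
  · rw [unipotent_mul, neg_add_cancel, unipotent_zero]
  · rw [unipotent_mul, neg_add_cancel, unipotent_zero]
  · rw [unipotent_mul, add_neg_cancel, unipotent_zero]
  · rw [Tmat_mul_unipotent, unipotent_mul_Tmat]
    congr 1
    ring
end
end
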